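/- Let 𝕜 be an algebraically closed field of characteristic p > 0, R = 𝕜[x_1,…,x_n], I = (f_1,…,f_r) an ideal of height c, S = R[u_{ij} : 1 ≤ i ≤ c, 1 ≤ j ≤ r], g_i := u_{i1}f_1 + ⋯ + u_{ir}f_r, and L := (g_1,…,g_c) ⊆ S. Let e ≥ 1 and let b ∈ ℕ with b < p^e. If (I^c)^{[b]} ⊄ 𝔫^{[p^e]} for every maximal ideal 𝔫 of R, then (L^c)^{[b]} ⊄ 𝔪^{[p^e]} for every maximal ideal 𝔪 of S. -/

import Mathlib

open Ideal MvPolynomial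

set_option synthInstance.maxHeartbeats 1000000
set_option maxHeartbeats 1000000

/-- The Frobenius `q`-th power of an ideal: the ideal generated by `q`-th powers of elements. -/
def Ideal.frobPow {A : Type*} [CommRing A] (q : ℕ) (I : Ideal A) : Ideal A :=
  Ideal.span ((fun h => h ^ q) '' (I : Set A))

/-- The bracket power `I^{[b]}` with respect to the base-`p` expansion of `b`. -/
def Ideal.bracketPow {A : Type*} [CommRing A] (p : ℕ) (I : Ideal A) (b : ℕ) : Ideal A :=
  ∏ i ∈ Finset.range (Nat.digits p b).length,
    Ideal.frobPow (p ^ i) (I ^ ((Nat.digits p b).getD i 0))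

/-- The least critical exponent of an ideal. -/
noncomputable def Ideal.lce {A : Type*} [CommRing A] (p : ℕ) (I : Ideal A) : ℝ :=
  sSup {t : ℝ | ∃ b e : ℕ, t = (b : ℝ) / (p : ℝ) ^ e ∧
    ∀ m : Ideal A, m.IsMaximal → ¬ (I.bracketPow p b ≤ m.frobPow (p ^ e))}

/-- The F-pure threshold of an ideal. -/
noncomputable def Ideal.fpt {A : Type*} [CommRing A] (p : ℕ) (I : Ideal A) : ℝ :=
  sSup {t : ℝ | ∃ a e : ℕ, t = (a : ℝ) / (p : ℝ) ^ e ∧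
    ∀ m : Ideal A, m.IsMaximal → ¬ (I ^ a ≤ m.frobPow (p ^ e))}

/-- The height of an ideal: the infimum of heights of primes containing it. -/
noncomputable def Ideal.idealHeight {A : Type*} [CommRing A] (I : Ideal A) : ℕ∞ :=
  ⨅ p : {p : PrimeSpectrum A // I ≤ p.asIdeal}, Order.height p.1


namespace Ideal

section Frobenius

variable {A : Type*} [CommRing A] (p : ℕ) [Fact p.Prime] [CharP A p]

theorem frobPow_prime_pow (e : ℕ) (J : Ideal A) :
    J.frobPow (p ^ e) = J.map (iterateFrobenius A p e) := rfl

theorem frobPow_prime_pow_succ (e : ℕ) (J : Ideal A) :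
    J.frobPow (p ^ (e + 1)) = (J.frobPow (p ^ e)).map (frobenius A p) := by
  rw [frobPow_prime_pow, frobPow_prime_pow, Ideal.map_map, add_comm, iterateFrobenius_add,
    iterateFrobenius_one]

/-- Splitting off the lowest base-`p` digit of the exponent of a bracket power. -/
theorem bracketPow_eq_mul_map_frobenius (J : Ideal A) {b : ℕ} (hb : b ≠ 0) :
    J.bracketPow p b = J ^ (b % p) * (J.bracketPow p (b / p)).map (frobenius A p) := by
  have hp : 1 < p := (Fact.out : p.Prime).one_lt
  have h0 : J.frobPow (p ^ 0) = J := by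
    rw [frobPow_prime_pow, iterateFrobenius_zero, Ideal.map_id]
  unfold Ideal.bracketPow
  rw [Nat.digits_def' hp (Nat.pos_of_ne_zero hb), List.length_cons, Finset.prod_range_succ',
    mul_comm]
  congr 1
  · rw [frobPow_prime_pow, iterateFrobenius_zero, Ideal.map_id]
    simp
  · rw [← Ideal.mapHom_apply, map_prod]
    refine Finset.prod_congr rfl fun i _ => ?_
    rw [frobPow_prime_pow_succ]
    simp

theorem pow_mem_bracketPow {J : Ideal A} {y : A} (hy : y ∈ J) (b : ℕ) :
    y ^ b ∈ J.bracketPow p b := by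
  induction b using Nat.strong_induction_on with
  | _ b ih =>
    rcases eq_or_ne b 0 with rfl | hb
    · simp [Ideal.bracketPow]
    · rw [bracketPow_eq_mul_map_frobenius p _ hb]
      have hyb : y ^ b = y ^ (b % p) * (y ^ (b / p)) ^ p := by
        rw [← pow_mul, ← pow_add, Nat.mod_add_div']
      rw [hyb]
      exact Ideal.mul_mem_mul (Ideal.pow_mem_pow hy _) (Ideal.mem_map_of_mem (frobenius A p)
        (ih _ (Nat.div_lt_self (Nat.pos_of_ne_zero hb) (Fact.out : p.Prime).one_lt)))

end Frobenius

/-- Generators of a power of a finitely generated ideal, indexed by exponent vectors. -/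
theorem span_range_pow_le {A ι : Type*} [CommRing A] [Fintype ι] (f : ι → A) (c a : ℕ)
    (J : Ideal A)
    (h : ∀ M : Fin c → ι → ℕ, (∀ k, ∑ j, M k j = a) → ∏ k, ∏ j, f j ^ M k j ∈ J) :
    (span (Set.range f) ^ c) ^ a ≤ J := by
  classical
  have hpow : (span (Set.range f) ^ c) ^ a =
      ∏ _k : Fin c, ∏ _t : Fin a, span (Set.range f) := by
    simp [← pow_mul, mul_comm]
  simp_rw [hpow, Ideal.prod_span, Ideal.span_le]
  intro x hx
  obtain ⟨y, hy, rfl⟩ := (Set.mem_fintype_prod _ _).mp hx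
  have hy' : ∀ k, ∃ s : Fin a → ι, ∏ t, f (s t) = y k := by
    intro k
    obtain ⟨z, hz, hzy⟩ := (Set.mem_fintype_prod _ _).mp (hy k)
    choose s hs using hz
    exact ⟨s, by simp_rw [hs, hzy]⟩
  choose s hs using hy'
  have key : ∀ k, y k = ∏ j, f j ^ (Finset.univ.filter fun t => s k t = j).card := by
    intro k
    rw [← hs k, Finset.prod_comp f (s k)]
    refine Finset.prod_subset (Finset.subset_univ _) fun j _ hj => ?_
    rw [Finset.card_eq_zero.mpr, pow_zero]
    refine Finset.filter_eq_empty_iff.mpr fun t _ ht => hj ?_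
    exact ht ▸ Finset.mem_image_of_mem _ (Finset.mem_univ t)
  simp_rw [SetLike.mem_coe, key]
  refine h _ fun k => ?_
  rw [← Finset.card_eq_sum_card_fiberwise (s := Finset.univ) (f := s k)
    (fun _ _ => Finset.mem_coe.mpr (Finset.mem_univ _)), Finset.card_univ, Fintype.card_fin]

end Ideal

namespace MvPolynomial

section Content

variable {σ A : Type*} [CommRing A]

/-- A polynomial in `𝔫 S + (X_k^q - λ_k)` all of whose exponents are smaller than `q` has its
coefficients in `𝔫`. -/
theorem coeff_mem_of_mem_map_C_sup_span [Fintype σ] {q : ℕ} (J : Ideal A) (l : σ → A)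
    {G : MvPolynomial σ A}
    (hG : G ∈ J.map (C : A →+* MvPolynomial σ A) ⊔
      Ideal.span (Set.range fun k => (X k ^ q - C (l k) : MvPolynomial σ A)))
    (hdeg : ∀ m ∈ G.support, ∀ k, m k < q) (m₀ : σ →₀ ℕ) : G.coeff m₀ ∈ J := by
  classical
  by_cases hm₀ : m₀ ∈ G.support
  swap
  · rw [notMem_support_iff.mp hm₀]; exact J.zero_mem
  have hlt := hdeg m₀ hm₀
  let w : (σ →₀ ℕ) → A := fun m =>
    ∏ k, if m k % q = m₀ k then l k ^ (m k / q) else 0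
  let φ : MvPolynomial σ A →ₗ[A] A := (basisMonomials σ A).constr A w
  have hφ : ∀ m a, φ (monomial m a) = a * w m := by
    intro m a
    have h1 : (monomial m a : MvPolynomial σ A) = a • basisMonomials σ A m := by
      simp [smul_monomial]
    rw [h1, map_smul, Module.Basis.constr_basis, smul_eq_mul]
  have hφsum : ∀ h : MvPolynomial σ A, φ h = ∑ m ∈ h.support, h.coeff m * w m := by
    intro h
    conv_lhs => rw [h.as_sum, map_sum]
    exact Finset.sum_congr rfl fun m _ => hφ _ _
  have hφG : φ G = G.coeff m₀ := by
    rw [hφsum, Finset.sum_eq_single m₀]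
    · have : w m₀ = 1 := Finset.prod_eq_one fun k _ => by
        simp [Nat.mod_eq_of_lt (hlt k), Nat.div_eq_of_lt (hlt k)]
      rw [this, mul_one]
    · intro m hm hne
      obtain ⟨k, hk⟩ := Finsupp.ne_iff.mp hne
      have : w m = 0 := Finset.prod_eq_zero (Finset.mem_univ k) (by
        rw [Nat.mod_eq_of_lt (hdeg m hm k), if_neg hk])
      rw [this, mul_zero]
    · exact fun h => absurd hm₀ h
  have hw : ∀ m k, w (m + Finsupp.single k q) = l k * w m := by
    intro m k
    have hq : 0 < q := (Nat.zero_le _).trans_lt (hlt k)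
    simp only [w]
    rw [← Finset.mul_prod_erase _ _ (Finset.mem_univ k),
      ← Finset.mul_prod_erase (Finset.univ) (fun k => if m k % q = m₀ k then l k ^ (m k / q) else 0)
        (Finset.mem_univ k), ← mul_assoc]
    congr 1
    · simp only [Finsupp.add_apply, Finsupp.single_eq_same, Nat.add_mod_right,
        Nat.add_div_right _ hq, mul_ite, mul_zero, pow_succ']
    · refine Finset.prod_congr rfl fun j hj => ?_
      rw [Finsupp.add_apply, Finsupp.single_eq_of_ne (Finset.ne_of_mem_erase hj), add_zero]
  have hker : ∀ k (s : MvPolynomial σ A), φ (s * (X k ^ q - C (l k))) = 0 := by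
    intro k s
    induction s using induction_on' with
    | monomial m a =>
      rw [mul_sub, map_sub, X_pow_eq_monomial, monomial_mul, mul_comm _ (C (l k)), C_mul_monomial,
        hφ, hφ, hw]
      ring
    | add s t hs ht => rw [add_mul, map_add, hs, ht, add_zero]
  obtain ⟨a, ha, z, hz, rfl⟩ := Submodule.mem_sup.mp hG
  have hza : φ z = 0 := by
    suffices h : ∀ s : MvPolynomial σ A, φ (s * z) = 0 by simpa using h 1
    clear hG hdeg hm₀ hφG
    induction hz using Submodule.span_induction with
    | mem x hx => obtain ⟨k, rfl⟩ := hx; exact hker k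
    | zero => simp
    | add x y _ _ hx hy => intro s; rw [mul_add, map_add, hx, hy, add_zero]
    | smul t x _ hx => intro s; rw [smul_eq_mul, ← mul_assoc]; exact hx _
  rw [← hφG, map_add, hza, add_zero, hφsum]
  exact J.sum_mem fun m _ => J.mul_mem_right _ (mem_map_C_iff.mp ha m)

variable (p : ℕ) [Fact p.Prime] [CharP A p]

/-- If the exponents of `B` are smaller than `p`, the monomials of `B * D ^ p` do not interfere. -/
theorem coeff_add_smul_mul_pow_char {B : MvPolynomial σ A}
    (hB : ∀ m ∈ B.support, ∀ k, m k < p) (D : MvPolynomial σ A) {m : σ →₀ ℕ}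
    (hm : ∀ k, m k < p) (m' : σ →₀ ℕ) :
    (B * D ^ p).coeff (m + p • m') = B.coeff m * D.coeff m' ^ p := by
  classical
  have hp : p ≠ 0 := (Fact.out : p.Prime).ne_zero
  rw [← map_frobenius_expand, coeff_mul, Finset.sum_eq_single (m, p • m')]
  · rw [coeff_map, coeff_expand_smul _ hp, frobenius_def]
  · rintro ⟨x, y⟩ hxy hne
    replace hxy := Finset.HasAntidiagonal.mem_antidiagonal.mp hxy
    dsimp only at hxy ⊢
    by_contra h0
    have hx : x ∈ B.support := mem_support_iff.mpr (left_ne_zero_of_mul h0)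
    have hy : ∀ k, p ∣ y k := by
      intro k
      by_contra hk
      apply right_ne_zero_of_mul h0
      rw [coeff_map, coeff_expand_of_not_dvd _ hk, map_zero]
    have hxm : x = m := by
      ext k
      have h1 := DFunLike.congr_fun hxy k
      simp only [Finsupp.add_apply, Finsupp.smul_apply, smul_eq_mul] at h1
      obtain ⟨t, ht⟩ := hy k
      have h2 := congrArg (· % p) h1
      simpa [ht, Nat.mod_eq_of_lt (hm k), Nat.mod_eq_of_lt (hB x hx k)] using h2
    subst hxm
    exact hne (by rw [add_left_cancel hxy])
  · intro h
    simp at h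

/-- The content ideal of `B * D ^ p` contains the content of `B` times the Frobenius power of the
content of `D`. -/
theorem span_coeff_mul_map_frobenius_le {B : MvPolynomial σ A}
    (hB : ∀ m ∈ B.support, ∀ k, m k < p) (D : MvPolynomial σ A) :
    Ideal.span (Set.range B.coeff) * (Ideal.span (Set.range D.coeff)).map (frobenius A p) ≤
      Ideal.span (Set.range (B * D ^ p).coeff) := by
  rw [Ideal.map_span, Ideal.span_mul_span', Ideal.span_le]
  rintro _ ⟨_, ⟨m, rfl⟩, _, ⟨_, ⟨m', rfl⟩, rfl⟩, rfl⟩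
  by_cases hm : m ∈ B.support
  · refine Ideal.subset_span ⟨m + p • m', ?_⟩
    exact coeff_add_smul_mul_pow_char p hB D (hB m hm) m'
  · rw [notMem_support_iff] at hm
    simp [hm]

end Content

section Generic

variable {A ι κ : Type*} [CommRing A] [Fintype ι] [Fintype κ]

/-- The coefficients of powers of a product of generic linear combinations. -/
theorem coeff_prod_generic_pow (f : ι → A) (b : ℕ) (m : κ × ι →₀ ℕ) :
    ((∏ k, ∑ j, X (k, j) * C (f j) : MvPolynomial (κ × ι) A) ^ b).coeff m =
      open Classical in
      if ∀ k, ∑ j, m (k, j) = b then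
        ∏ k, ((Nat.multinomial Finset.univ (fun j => m (k, j)) : A) * ∏ j, f j ^ m (k, j))
      else 0 := by
  classical
  let F : (κ → ι → ℕ) → (κ × ι →₀ ℕ) := fun M =>
    Finsupp.equivFunOnFinite.symm fun x => M x.1 x.2
  have hterm : ∀ M : κ → ι → ℕ,
      (∏ k, ((Nat.multinomial Finset.univ (M k) : MvPolynomial (κ × ι) A) *
        ∏ j, (X (k, j) * C (f j)) ^ M k j)) =
      monomial (F M) (∏ k, ((Nat.multinomial Finset.univ (M k) : A) * ∏ j, f j ^ M k j)) := by
    intro M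
    rw [monomial_eq, Finsupp.prod_fintype _ _ (by simp), Fintype.prod_prod_type, map_prod,
      ← Finset.prod_mul_distrib]
    refine Finset.prod_congr rfl fun k _ => ?_
    simp only [mul_pow, Finset.prod_mul_distrib, map_mul, map_natCast, map_prod, map_pow, F,
      Finsupp.equivFunOnFinite_symm_apply_apply]
    ring
  rw [← Finset.prod_pow]
  simp_rw [Finset.sum_pow_eq_sum_piAntidiag]
  rw [Finset.prod_univ_sum]
  simp_rw [hterm, coeff_sum, coeff_monomial]
  have hF : ∀ M, F M = m ↔ M = fun k j => m (k, j) := by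
    intro M
    constructor
    · rintro rfl; rfl
    · rintro rfl; ext ⟨k, j⟩; rfl
  simp_rw [hF]
  rw [Finset.sum_ite_eq']
  simp [Fintype.mem_piFinset, Finset.mem_piAntidiag]

theorem le_of_mem_support_prod_generic_pow {f : ι → A} {b : ℕ} {m : κ × ι →₀ ℕ}
    (hm : m ∈ ((∏ k, ∑ j, X (k, j) * C (f j) : MvPolynomial (κ × ι) A) ^ b).support)
    (x : κ × ι) : m x ≤ b := by
  classical
  rw [mem_support_iff, coeff_prod_generic_pow] at hm
  have h := (ite_ne_right_iff.mp hm).1 x.1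
  rw [← h]
  exact Finset.single_le_sum (f := fun j => m (x.1, j)) (fun _ _ => Nat.zero_le _)
    (Finset.mem_univ x.2)

variable (p : ℕ) [Fact p.Prime] [CharP A p]

theorem span_pow_le_span_coeff_prod_generic_pow (f : ι → A) (c : ℕ) {a : ℕ} (ha : a < p) :
    (Ideal.span (Set.range f) ^ c) ^ a ≤ Ideal.span (Set.range
      ((∏ k, ∑ j, X (k, j) * C (f j) : MvPolynomial (Fin c × ι) A) ^ a).coeff) := by
  classical
  have hp : p.Prime := Fact.out
  refine Ideal.span_range_pow_le f c a _ fun M hM => ?_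
  have hunit : IsUnit (∏ k, (Nat.multinomial Finset.univ (M k) : A)) := by
    rw [← Nat.cast_prod, CharP.isUnit_natCast_iff hp, hp.prime.dvd_finsetProd_iff]
    rintro ⟨k, -, hk⟩
    refine (hp.dvd_factorial.not.mpr ha.not_ge) ?_
    rw [← hM k, ← Nat.multinomial_spec]
    exact hk.mul_left _
  rw [← Ideal.unit_mul_mem_iff_mem _ hunit, ← Finset.prod_mul_distrib]
  refine Ideal.subset_span ⟨Finsupp.equivFunOnFinite.symm fun x => M x.1 x.2, ?_⟩
  dsimp only
  rw [coeff_prod_generic_pow, if_pos (by simpa using hM)]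
  simp

/-- The bracket power of `I ^ c` is contained in the content ideal of the corresponding power of
the product of `c` generic elements of `I`. -/
theorem bracketPow_le_span_coeff_prod_generic_pow (f : ι → A) (c b : ℕ) :
    (Ideal.span (Set.range f) ^ c).bracketPow p b ≤ Ideal.span (Set.range
      ((∏ k, ∑ j, X (k, j) * C (f j) : MvPolynomial (Fin c × ι) A) ^ b).coeff) := by
  have hp : p.Prime := Fact.out
  induction b using Nat.strong_induction_on with
  | _ b ih =>
    rcases eq_or_ne b 0 with rfl | hb
    · have h1 : (1 : A) ∈ Ideal.span (Set.range
          ((∏ k, ∑ j, X (k, j) * C (f j) : MvPolynomial (Fin c × ι) A) ^ 0).coeff) :=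
        Ideal.subset_span ⟨0, by simp⟩
      exact le_top.trans_eq ((Ideal.eq_top_iff_one _).mpr h1).symm
    · rw [Ideal.bracketPow_eq_mul_map_frobenius p _ hb]
      conv_rhs => rw [← Nat.mod_add_div' b p, pow_add, pow_mul]
      have hlt : b % p < p := Nat.mod_lt _ hp.pos
      exact (Ideal.mul_mono (span_pow_le_span_coeff_prod_generic_pow p f c hlt)
        (Ideal.map_mono (ih _ (Nat.div_lt_self (Nat.pos_of_ne_zero hb) hp.one_lt)))).trans
        (span_coeff_mul_map_frobenius_le p
          (fun m hm k => (le_of_mem_support_prod_generic_pow hm k).trans_lt hlt) _)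

end Generic

/-- Maximal ideals of a polynomial ring over an affine `𝕜`-algebra: the contraction is maximal and
each variable is congruent to a scalar. -/
theorem exists_le_map_C_sup_span {𝕜 A σ : Type*} [Field 𝕜] [IsAlgClosed 𝕜] [CommRing A]
    [Algebra 𝕜 A] [Algebra.FiniteType 𝕜 A] [Finite σ] (𝔪 : Ideal (MvPolynomial σ A))
    [h𝔪 : 𝔪.IsMaximal] :
    (𝔪.comap (C : A →+* MvPolynomial σ A)).IsMaximal ∧ ∃ l : σ → A,
      𝔪 ≤ (𝔪.comap C).map (C : A →+* MvPolynomial σ A) ⊔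
        Ideal.span (Set.range fun k => (X k - C (l k) : MvPolynomial σ A)) := by
  let _ : Field (MvPolynomial σ A ⧸ 𝔪) := Ideal.Quotient.field 𝔪
  have : Algebra.FiniteType 𝕜 (MvPolynomial σ A) :=
    Algebra.FiniteType.trans (S := A) inferInstance inferInstance
  have : Algebra.FiniteType 𝕜 (MvPolynomial σ A ⧸ 𝔪) :=
    Algebra.FiniteType.trans (S := MvPolynomial σ A) inferInstance inferInstance
  have : Module.Finite 𝕜 (MvPolynomial σ A ⧸ 𝔪) := finite_of_finite_type_of_isJacobsonRing _ _
  have hsurj : Function.Surjective (algebraMap 𝕜 (MvPolynomial σ A ⧸ 𝔪)) :=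
    IsAlgClosed.algebraMap_bijective_of_isIntegral.2
  have hC : Function.Surjective ((Ideal.Quotient.mk 𝔪).comp (C : A →+* MvPolynomial σ A)) := by
    intro y
    obtain ⟨z, rfl⟩ := hsurj y
    exact ⟨algebraMap 𝕜 A z, rfl⟩
  refine ⟨?_, ?_⟩
  · have := RingHom.ker_isMaximal_of_surjective _ hC
    rwa [← RingHom.comap_ker, Ideal.mk_ker] at this
  · choose l hl using fun k => hC (Ideal.Quotient.mk 𝔪 (X k))
    refine ⟨l, fun h hh => ?_⟩
    set N := Ideal.span (Set.range fun k => (X k - C (l k) : MvPolynomial σ A)) with hN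
    have hN𝔪 : N ≤ 𝔪 := by
      rw [hN, Ideal.span_le]
      rintro _ ⟨k, rfl⟩
      exact Ideal.Quotient.eq.mp (hl k).symm
    have hmem : h - C (eval l h) ∈ N := by
      rw [← Ideal.Quotient.eq]
      have : (Ideal.Quotient.mk N) = ((Ideal.Quotient.mk N).comp C).comp (eval l) := by
        refine ringHom_ext (fun a => by simp) fun k => ?_
        rw [RingHom.comp_apply, eval_X]
        exact Ideal.Quotient.eq.mpr (Ideal.subset_span ⟨k, rfl⟩)
      exact DFunLike.congr_fun this h
    rw [← sub_add_cancel h (C (eval l h)), add_comm]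
    refine Submodule.add_mem_sup (Ideal.mem_map_of_mem _ ?_) hmem
    have := 𝔪.sub_mem hh (hN𝔪 hmem)
    rwa [sub_sub_cancel] at this

end MvPolynomial

/-- If `(I^c)^{[b]} ⊄ 𝔫^{[p^e]}` for every maximal ideal `𝔫` of `R`, then
`(L^c)^{[b]} ⊄ 𝔪^{[p^e]}` for every maximal ideal `𝔪` of `S`. -/
theorem bracketPow_not_le_of_bracketPow_not_le
    {𝕜 : Type*} [Field 𝕜] [IsAlgClosed 𝕜] {p : ℕ} [Fact p.Prime] [CharP 𝕜 p]
    (n r c : ℕ) (f : Fin r → MvPolynomial (Fin n) 𝕜)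
    (I : Ideal (MvPolynomial (Fin n) 𝕜)) (hI : I = Ideal.span (Set.range f))
    (hht : I.idealHeight = (c : ℕ∞))
    (g : Fin c → MvPolynomial (Fin c × Fin r) (MvPolynomial (Fin n) 𝕜))
    (hg : ∀ i, g i = ∑ j : Fin r, X (i, j) * C (f j))
    (L : Ideal (MvPolynomial (Fin c × Fin r) (MvPolynomial (Fin n) 𝕜)))
    (hL : L = Ideal.span (Set.range g))
    (e b : ℕ) (he : 1 ≤ e) (hb : b < p ^ e)
    (hIb : ∀ 𝔫 : Ideal (MvPolynomial (Fin n) 𝕜), 𝔫.IsMaximal →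
      ¬ ((I ^ c).bracketPow p b ≤ 𝔫.frobPow (p ^ e))) :
    ∀ 𝔪 : Ideal (MvPolynomial (Fin c × Fin r) (MvPolynomial (Fin n) 𝕜)), 𝔪.IsMaximal →
      ¬ ((L ^ c).bracketPow p b ≤ 𝔪.frobPow (p ^ e)) := by
  rintro 𝔪 h𝔪 hle
  obtain ⟨hmax, l, hl⟩ := exists_le_map_C_sup_span (𝕜 := 𝕜) 𝔪
  refine hIb _ hmax ?_
  subst hI hL
  refine (bracketPow_le_span_coeff_prod_generic_pow p f c b).trans (Ideal.span_le.mpr ?_)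
  rintro _ ⟨m, rfl⟩
  refine coeff_mem_of_mem_map_C_sup_span (q := p ^ e) _ (fun k => l k ^ p ^ e) ?_
    (fun m hm k => (le_of_mem_support_prod_generic_pow hm k).trans_lt hb) m
  have hG : (∏ k, ∑ j, X (k, j) * C (f j)) ∈ Ideal.span (Set.range g) ^ c := by
    have := Ideal.prod_mem_prod (s := Finset.univ) (I := fun _ : Fin c => Ideal.span (Set.range g))
      (x := g) fun k _ => Ideal.subset_span ⟨k, rfl⟩
    simpa [hg] using this
  have hmem := Ideal.map_mono (f := iterateFrobenius _ p e) hl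
    (hle (Ideal.pow_mem_bracketPow p hG b))
  rw [Ideal.map_sup, Ideal.map_map, Ideal.map_span, ← Set.range_comp] at hmem
  convert hmem using 2
  · rw [Ideal.frobPow_prime_pow, Ideal.map_map]
    congr 1
    exact RingHom.ext fun x => by simp [iterateFrobenius_def]
  · congr 2
    ext k
    simp [iterateFrobenius_def, sub_pow_char_pow]
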